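/- Let N ≥ 3 and b ∈ (2, N). Then for every x ∈ ℝ^N with |x| > 1, ∫_{ℝ^N} dy / ((1+|x-y|^b)|y|^{N-1}) ≍ |x|^{1-b}, i.e., there exist constants c, C > 0 depending only on N and b such that c|x|^{1-b} ≤ ∫_{ℝ^N} dy/((1+|x-y|^b)|y|^{N-1}) ≤ C|x|^{1-b} for all |x| > 1. -/

import Mathlib

open MeasureTheory

open Metric Module Set

/-- If `s` and `t` are the distances of a point to two points at mutual distance `1`, the product of
two inverse powers of `s` and `t` splits into two local singularities and a tail. -/
theorem one_div_rpow_mul_rpow_le {a b s t : ℝ} (ha : 0 ≤ a) (hb : 0 ≤ b) (hs : 0 < s) (ht : 0 < t)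
    (hst : 1 ≤ s + t) (hts : t ≤ 1 + s) :
    1 / (s ^ b * t ^ a) ≤
      2 ^ b * (if t < 1 / 2 then t ^ (-a) else 0) + 2 ^ a * (if s < 1 / 2 then s ^ (-b) else 0) +
        5 ^ b * 3 ^ a * (1 + t) ^ (-(b + a)) := by
  have key {p c u v : ℝ} (hp : 0 ≤ p) (hu : 0 < u) (hv : 0 < v) (hc : 0 < c) (h : v ≤ c * u) :
      u ^ (-p) ≤ c ^ p * v ^ (-p) := by
    rw [Real.rpow_neg hu.le, Real.rpow_neg hv.le, ← div_eq_mul_inv, inv_le_comm₀ (by positivity)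
      (by positivity), inv_div, div_le_iff₀ (by positivity), mul_comm,
      ← Real.mul_rpow hc.le hu.le]
    exact Real.rpow_le_rpow hv.le h hp
  have hform : 1 / (s ^ b * t ^ a) = s ^ (-b) * t ^ (-a) := by
    rw [Real.rpow_neg hs.le, Real.rpow_neg ht.le, one_div, mul_inv]
  have h₁ : 0 ≤ 2 ^ b * (if t < 1 / 2 then t ^ (-a) else 0) := by
    split_ifs <;> positivity
  have h₂ : 0 ≤ 2 ^ a * (if s < 1 / 2 then s ^ (-b) else 0) := by
    split_ifs <;> positivity
  have h₃ : 0 ≤ 5 ^ b * 3 ^ a * (1 + t) ^ (-(b + a)) := by positivity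
  rw [hform]
  by_cases ht' : t < 1 / 2
  · have h := key hb hs one_pos two_pos (by linarith)
    rw [Real.one_rpow, mul_one] at h
    have : s ^ (-b) * t ^ (-a) ≤ 2 ^ b * t ^ (-a) := by gcongr
    rw [if_pos ht'] at h₁ ⊢
    linarith
  by_cases hs' : s < 1 / 2
  · have h := key ha ht one_pos two_pos (by linarith)
    rw [Real.one_rpow, mul_one] at h
    have : s ^ (-b) * t ^ (-a) ≤ s ^ (-b) * 2 ^ a := by gcongr
    rw [if_pos hs'] at h₂ ⊢
    linarith
  have h : s ^ (-b) * t ^ (-a) ≤ (5 ^ b * (1 + t) ^ (-b)) * (3 ^ a * (1 + t) ^ (-a)) := by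
    gcongr
    · exact key hb hs (by positivity) (by norm_num) (by linarith)
    · exact key ha ht (by positivity) (by norm_num) (by linarith)
  have hadd : (1 + t) ^ (-(b + a)) = (1 + t) ^ (-b) * (1 + t) ^ (-a) := by
    rw [neg_add, Real.rpow_add (by positivity)]
  rw [hadd] at h₃ ⊢
  linarith

section

variable {E : Type*} [NormedAddCommGroup E] [NormedSpace ℝ E] [FiniteDimensional ℝ E]
  [MeasurableSpace E] [BorelSpace E]

theorem integrable_ite_norm_rpow_neg (μ : Measure E) [μ.IsAddHaarMeasure] {a : ℝ} (R : ℝ)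
    (hd : 1 ≤ finrank ℝ E) (ha : a < finrank ℝ E) :
    Integrable (fun z : E => if ‖z‖ < R then ‖z‖ ^ (-a) else 0) μ := by
  have h : IntegrableOn (fun z : E => ‖z‖ ^ (-a)) (ball 0 R) μ := by
    refine integrableOn_ball_of_norm_le_rpow (C := 1) hd ha (ae_of_all _ fun z => ?_)
      (Measurable.aestronglyMeasurable (by fun_prop))
    rw [Real.norm_of_nonneg (by positivity), one_mul]
  rw [← integrable_indicator_iff measurableSet_ball] at h
  refine h.congr (ae_of_all _ fun z => ?_)
  by_cases hz : ‖z‖ < R <;> simp [hz]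

/-- The product of two inverse powers with singularities at `0` and at a unit vector is dominated by
an integrable function whose integral does not depend on the unit vector. -/
theorem exists_integrable_bound_one_div_rpow_mul_rpow (μ : Measure E) [μ.IsAddHaarMeasure]
    {a b : ℝ} (hd : 1 ≤ finrank ℝ E) (ha : 0 ≤ a) (hb : 0 ≤ b) (had : a < finrank ℝ E)
    (hbd : b < finrank ℝ E) (hab : finrank ℝ E < b + a) :
    ∃ C : ℝ, ∀ e : E, ‖e‖ = 1 → ∃ g : E → ℝ, Integrable g μ ∧ ∫ z, g z ∂μ = C ∧
      ∀ᵐ z ∂μ, 1 / (‖e - z‖ ^ b * ‖z‖ ^ a) ≤ g z := by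
  have : Nontrivial E := Module.nontrivial_of_finrank_pos (R := ℝ) hd
  let g₁ : E → ℝ := fun z => 2 ^ b * (if ‖z‖ < 1 / 2 then ‖z‖ ^ (-a) else 0)
  let g₂ : E → ℝ := fun z => 2 ^ a * (if ‖z‖ < 1 / 2 then ‖z‖ ^ (-b) else 0)
  let g₃ : E → ℝ := fun z => 5 ^ b * 3 ^ a * (1 + ‖z‖) ^ (-(b + a))
  have h₁ : Integrable g₁ μ := (integrable_ite_norm_rpow_neg μ _ hd had).const_mul _
  have h₂ : Integrable g₂ μ := (integrable_ite_norm_rpow_neg μ _ hd hbd).const_mul _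
  have h₃ : Integrable g₃ μ := (integrable_one_add_norm hab).const_mul _
  refine ⟨(∫ z, g₁ z ∂μ) + (∫ z, g₂ z ∂μ) + ∫ z, g₃ z ∂μ, fun e he =>
    ⟨fun z => g₁ z + g₂ (e - z) + g₃ z, (h₁.add (h₂.comp_sub_left e)).add h₃, ?_, ?_⟩⟩
  · have h₂' : Integrable (fun z => g₂ (e - z)) μ := h₂.comp_sub_left e
    have h₁₂ : Integrable (fun z => g₁ z + g₂ (e - z)) μ := h₁.add h₂'
    beta_reduce
    rw [integral_add h₁₂ h₃, integral_add h₁ h₂', integral_sub_left_eq_self g₂ μ e]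
  · filter_upwards [μ.ae_ne 0, μ.ae_ne e] with z hz hze
    refine one_div_rpow_mul_rpow_le ha hb (norm_pos_iff.2 (sub_ne_zero.2 hze.symm))
      (norm_pos_iff.2 hz) ?_ ?_
    · simpa [he] using norm_add_le (e - z) z
    · simpa [he] using norm_sub_le e (e - z)

end

/-- For `N ≥ 3` and `2 < b < N`, there are constants
`c, C > 0` (depending only on `N, b`) with
`c|x|^(1-b) ≤ ∫ dy/((1+|x-y|^b)|y|^(N-1)) ≤ C|x|^(1-b)` for all `|x| > 1`. -/
theorem stmt14 (N : ℕ) (hN : 3 ≤ N) (b : ℝ) (hb : 2 < b) (hbN : b < N) :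
    ∃ c C : ℝ, 0 < c ∧ 0 < C ∧
      ∀ x : EuclideanSpace ℝ (Fin N), 1 < ‖x‖ →
        c * ‖x‖ ^ (1 - b) ≤
          (∫ y : EuclideanSpace ℝ (Fin N),
            1 / ((1 + ‖x - y‖ ^ b) * ‖y‖ ^ ((N : ℝ) - 1))) ∧
        (∫ y : EuclideanSpace ℝ (Fin N),
            1 / ((1 + ‖x - y‖ ^ b) * ‖y‖ ^ ((N : ℝ) - 1))) ≤ C * ‖x‖ ^ (1 - b) := by
  have hfin : finrank ℝ (EuclideanSpace ℝ (Fin N)) = N := by simp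
  have hN' : (3 : ℝ) ≤ N := by exact_mod_cast hN
  have : Nontrivial (EuclideanSpace ℝ (Fin N)) :=
    Module.nontrivial_of_finrank_pos (R := ℝ) (by omega)
  set a : ℝ := (N : ℝ) - 1 with ha
  obtain ⟨C, hC⟩ := exists_integrable_bound_one_div_rpow_mul_rpow
    (volume : Measure (EuclideanSpace ℝ (Fin N))) (a := a) (b := b) (by omega) (by linarith)
    (by linarith) (by rw [hfin]; linarith) (by rwa [hfin]) (by rw [hfin]; linarith)
  let V : ℝ := volume.real (ball (0 : EuclideanSpace ℝ (Fin N)) 1)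
  have hV : 0 < V := ENNReal.toReal_pos (measure_ball_pos _ _ one_pos).ne' measure_ball_lt_top.ne
  refine ⟨V * (1 / (1 + 2 ^ b)), max C 1, by positivity, by positivity, fun x hx => ?_⟩
  set r := ‖x‖
  have hr : 0 < r := by linarith
  set F : EuclideanSpace ℝ (Fin N) → ℝ := fun y => 1 / ((1 + ‖x - y‖ ^ b) * ‖y‖ ^ a) with hF
  have hunit : ‖r⁻¹ • x‖ = 1 := by
    rw [norm_smul, norm_inv, Real.norm_of_nonneg hr.le]
    exact inv_mul_cancel₀ hr.ne'
  obtain ⟨g, hg, hgC, hgb⟩ := hC (r⁻¹ • x) hunit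
  have hscale : ∫ y, F y = r ^ N * ∫ z, F (r • z) := by
    rw [Measure.integral_comp_smul_of_nonneg volume F r (hR := hr.le), hfin, smul_eq_mul,
      mul_inv_cancel_left₀ (by positivity)]
  have hpow : r ^ N * r ^ (-(b + a)) = r ^ (1 - b) := by
    rw [← Real.rpow_natCast, ← Real.rpow_add hr]
    congr 1
    rw [ha]; ring
  have hFr (z) : F (r • z) = 1 / ((1 + r ^ b * ‖r⁻¹ • x - z‖ ^ b) * (r ^ a * ‖z‖ ^ a)) := by
    have h₁ : x - r • z = r • (r⁻¹ • x - z) := by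
      rw [smul_sub, smul_inv_smul₀ hr.ne']
    simp only [hF]
    rw [h₁, norm_smul, norm_smul, Real.norm_of_nonneg hr.le,
      Real.mul_rpow hr.le (norm_nonneg _), Real.mul_rpow hr.le (norm_nonneg _)]
  have hF0 (z) : 0 ≤ F z := by simp only [hF]; positivity
  have hr' : r ^ (-(b + a)) = (r ^ b * r ^ a)⁻¹ := by
    rw [Real.rpow_neg hr.le, Real.rpow_add hr]
  have hupper : ∀ᵐ z, F (r • z) ≤ r ^ (-(b + a)) * g z := by
    filter_upwards [hgb, volume.ae_ne 0, volume.ae_ne (r⁻¹ • x)] with z hz hz0 hze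
    have hs : 0 < ‖r⁻¹ • x - z‖ := norm_pos_iff.2 (sub_ne_zero.2 hze.symm)
    have ht : 0 < ‖z‖ := norm_pos_iff.2 hz0
    calc F (r • z) ≤ 1 / ((r ^ b * ‖r⁻¹ • x - z‖ ^ b) * (r ^ a * ‖z‖ ^ a)) := by
          rw [hFr]
          gcongr
          linarith
      _ = r ^ (-(b + a)) * (1 / (‖r⁻¹ • x - z‖ ^ b * ‖z‖ ^ a)) := by
          rw [hr']
          field_simp
      _ ≤ r ^ (-(b + a)) * g z := by gcongr
  have hFint : Integrable (fun z => F (r • z)) := by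
    refine (hg.const_mul (r ^ (-(b + a)))).mono'
      (Measurable.aestronglyMeasurable (by simp only [hF]; fun_prop)) ?_
    filter_upwards [hupper] with z hz
    rwa [Real.norm_of_nonneg (hF0 _)]
  have hlower : ∀ᵐ z, (ball 0 1).indicator (fun _ => r ^ (-(b + a)) * (1 / (1 + 2 ^ b))) z ≤
      F (r • z) := by
    filter_upwards [volume.ae_ne 0] with z hz0
    by_cases hz : z ∈ ball (0 : EuclideanSpace ℝ (Fin N)) 1
    · have ht : 0 < ‖z‖ := norm_pos_iff.2 hz0
      have ht1 : ‖z‖ ≤ 1 := (mem_ball_zero_iff.1 hz).le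
      have hs : ‖r⁻¹ • x - z‖ ≤ 2 := by
        refine (norm_sub_le _ _).trans ?_
        rw [hunit]
        linarith
      rw [indicator_of_mem hz, hFr, hr', ← one_div, one_div_mul_one_div]
      have h₁ : 1 + r ^ b * ‖r⁻¹ • x - z‖ ^ b ≤ r ^ b * (1 + 2 ^ b) := by
        have : r ^ b * ‖r⁻¹ • x - z‖ ^ b ≤ r ^ b * 2 ^ b := by gcongr
        have : 1 ≤ r ^ b := Real.one_le_rpow hx.le (by linarith)
        linarith
      have h₂ : r ^ a * ‖z‖ ^ a ≤ r ^ a :=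
        mul_le_of_le_one_right (by positivity)
          (Real.rpow_le_one (norm_nonneg _) ht1 (by linarith))
      refine one_div_le_one_div_of_le (by positivity) ?_
      calc _ ≤ r ^ b * (1 + 2 ^ b) * r ^ a := by gcongr
        _ = r ^ b * r ^ a * (1 + 2 ^ b) := by ring
    · rw [indicator_of_notMem hz]
      exact hF0 _
  constructor
  · have h := integral_mono_ae
      ((integrable_indicator_iff measurableSet_ball).2 (integrableOn_const measure_ball_lt_top.ne))
      hFint hlower
    rw [integral_indicator measurableSet_ball, setIntegral_const, smul_eq_mul] at h
    calc V * (1 / (1 + 2 ^ b)) * r ^ (1 - b)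
        = r ^ N * (V * (r ^ (-(b + a)) * (1 / (1 + 2 ^ b)))) := by rw [← hpow]; ring
      _ ≤ ∫ y, F y := by rw [hscale]; gcongr
  · have h := integral_mono_ae hFint (hg.const_mul (r ^ (-(b + a)))) hupper
    rw [integral_const_mul, hgC] at h
    calc ∫ y, F y ≤ r ^ N * (r ^ (-(b + a)) * C) := by rw [hscale]; gcongr
      _ = C * r ^ (1 - b) := by rw [← hpow]; ring
      _ ≤ max C 1 * r ^ (1 - b) := by gcongr; exact le_max_left _ _
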